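/- arXiv:0906.2643 — 10 statements merged into one kernel-verified Lean document; each statement's English description precedes it below -/
import Mathlib

section
/- Let (X, Y) satisfy equation (1.1) with Y ∈ GL_n(F). Then Y⁻¹ + ε̃(Y⁻¹) = (Y⁻¹X)·(Y⁻¹X)'; that is, the pair (Y⁻¹X, Y⁻¹) also satisfies equation (1.1). (Hence the collection of ε-twisted conjugacy classes for which (1.1) has a solution is closed under inversion.) -/
open Matrix

/-- The `k × k` antidiagonal matrix `w_k` with `(w_k)_{i, k+1-i} = 1` (1-indexed). -/
noncomputable def wMat (F : Type*) [Field F] (k : ℕ) : Matrix (Fin k) (Fin k) F :=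
  Matrix.of fun i j => if (i : ℕ) + (j : ℕ) = k - 1 then 1 else 0

/-- `ε(g) = w_n · ᵗg⁻¹ · w_n⁻¹`. -/
noncomputable def eps (F : Type*) [Field F] (n : ℕ) (g : Matrix (Fin n) (Fin n) F) :
    Matrix (Fin n) (Fin n) F :=
  wMat F n * (g⁻¹)ᵀ * (wMat F n)⁻¹

/-- `ε̃(Y) = w_n · ᵗY · w_n`. -/
noncomputable def epsTilde (F : Type*) [Field F] (n : ℕ) (Y : Matrix (Fin n) (Fin n) F) :
    Matrix (Fin n) (Fin n) F :=
  wMat F n * Yᵀ * wMat F n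

/-- `X' = -w_{2m+1} · ᵗX · w_n`. -/
noncomputable def Xpr (F : Type*) [Field F] (n m : ℕ)
    (X : Matrix (Fin n) (Fin (2 * m + 1)) F) : Matrix (Fin (2 * m + 1)) (Fin n) F :=
  -(wMat F (2 * m + 1)) * Xᵀ * wMat F n

/-- Equation (1.1): `Y + ε̃(Y) = X·X'`. -/
def Eq11 (F : Type*) [Field F] (n m : ℕ)
    (X : Matrix (Fin n) (Fin (2 * m + 1)) F) (Y : Matrix (Fin n) (Fin n) F) : Prop :=
  Y + epsTilde F n Y = X * Xpr F n m X

/-- Membership in `SO_{2m+1}(F)`: `h · w_{2m+1} · ᵗh = w_{2m+1}` and `det h = 1`. -/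
def SOw (F : Type*) [Field F] (k : ℕ) (h : Matrix (Fin k) (Fin k) F) : Prop :=
  h * wMat F k * hᵀ = wMat F k ∧ h.det = 1

theorem wMat_mul_self (F : Type*) [Field F] (k : ℕ) : wMat F k * wMat F k = 1 := by
  ext i j
  rw [Matrix.mul_apply, Finset.sum_eq_single (Fin.rev i)]
  · simp only [wMat, Matrix.of_apply, Matrix.one_apply, Fin.val_rev, Fin.ext_iff]
    split_ifs <;> first | omega | simp
  · intro l _ hl
    simp only [wMat, Matrix.of_apply]
    rw [if_neg, zero_mul]
    intro h
    apply hl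
    ext
    rw [Fin.val_rev]
    omega
  · simp

theorem epsTilde_one (F : Type*) [Field F] (n : ℕ) : epsTilde F n 1 = 1 := by
  simp [epsTilde, wMat_mul_self]

theorem epsTilde_mul (F : Type*) [Field F] (n : ℕ) (A B : Matrix (Fin n) (Fin n) F) :
    epsTilde F n (A * B) = epsTilde F n B * epsTilde F n A := by
  calc
    _ = wMat F n * Bᵀ * 1 * Aᵀ * wMat F n := by
      simp only [epsTilde, Matrix.transpose_mul, Matrix.mul_assoc, Matrix.one_mul]
    _ = _ := by
      rw [← wMat_mul_self F n]
      simp only [epsTilde, Matrix.mul_assoc]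

theorem Xpr_mul (F : Type*) [Field F] (n m : ℕ) (A : Matrix (Fin n) (Fin n) F)
    (X : Matrix (Fin n) (Fin (2 * m + 1)) F) :
    Xpr F n m (A * X) = Xpr F n m X * epsTilde F n A := by
  calc
    _ = -wMat F (2 * m + 1) * Xᵀ * (1 : Matrix (Fin n) (Fin n) F) * Aᵀ * wMat F n := by
      simp only [Xpr, Matrix.transpose_mul, Matrix.mul_assoc, Matrix.one_mul]
    _ = _ := by
      rw [← wMat_mul_self F n]
      simp only [Xpr, epsTilde, Matrix.mul_assoc]

/-- if `(X, Y)` satisfies (1.1) with `Y` invertible, then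
`(Y⁻¹X, Y⁻¹)` also satisfies (1.1). -/
theorem eq11_closed_under_inversion (F : Type*) [Field F] [CharZero F] (n m : ℕ)
    (X : Matrix (Fin n) (Fin (2 * m + 1)) F) (Y : Matrix (Fin n) (Fin n) F)
    (hY : IsUnit Y) (h : Eq11 F n m X Y) :
    Eq11 F n m (Y⁻¹ * X) Y⁻¹ := by
  have hdet : IsUnit Y.det := (Matrix.isUnit_iff_isUnit_det Y).mp hY
  have hinv : epsTilde F n Y * epsTilde F n Y⁻¹ = 1 := by
    rw [← epsTilde_mul, Matrix.nonsing_inv_mul Y hdet, epsTilde_one]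
  unfold Eq11 at h ⊢
  rw [Xpr_mul, Matrix.mul_assoc, ← Matrix.mul_assoc X, ← h, Matrix.add_mul, hinv,
    Matrix.mul_add, ← Matrix.mul_assoc, Matrix.nonsing_inv_mul Y hdet, Matrix.one_mul,
    Matrix.mul_one, add_comm]
end

section
/- (Lemma 1.1) Let (X, Y) satisfy equation (1.1), let u be the block matrix u = [[I_n, X, Y], [0, I_{2m+1}, X'], [0, 0, I_n]] of size (2n+2m+1)×(2n+2m+1), and let w₀ = [[0, 0, I_n], [0, (-1)ⁿ I_{2m+1}, 0], [I_n, 0, 0]] (note w₀⁻¹ = w₀). If Y ∈ GL_n(F), then w₀⁻¹·u = A·B, where A = [[ε(Y), -Y⁻¹X, I_n], [0, (-1)ⁿ(I_{2m+1} - X'Y⁻¹X), (-1)ⁿX'], [0, 0, Y]] and B = [[I_n, 0, 0], [(Y⁻¹X)', I_{2m+1}, 0], [Y⁻¹, Y⁻¹X, I_n]], where (Y⁻¹X)' = -w_{2m+1} · ᵗ(Y⁻¹X) · w_n. -/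
open Matrix

/-- A `3 × 3` block matrix. -/
def block3 {F : Type*} {p q r p' q' r' : Type*}
    (A : Matrix p p' F) (B : Matrix p q' F) (C : Matrix p r' F)
    (D : Matrix q p' F) (E : Matrix q q' F) (G : Matrix q r' F)
    (H : Matrix r p' F) (J : Matrix r q' F) (K : Matrix r r' F) :
    Matrix (p ⊕ q ⊕ r) (p' ⊕ q' ⊕ r') F :=
  Matrix.of fun i j =>
    match i, j with
    | Sum.inl i, Sum.inl j => A i j
    | Sum.inl i, Sum.inr (Sum.inl j) => B i j
    | Sum.inl i, Sum.inr (Sum.inr j) => C i j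
    | Sum.inr (Sum.inl i), Sum.inl j => D i j
    | Sum.inr (Sum.inl i), Sum.inr (Sum.inl j) => E i j
    | Sum.inr (Sum.inl i), Sum.inr (Sum.inr j) => G i j
    | Sum.inr (Sum.inr i), Sum.inl j => H i j
    | Sum.inr (Sum.inr i), Sum.inr (Sum.inl j) => J i j
    | Sum.inr (Sum.inr i), Sum.inr (Sum.inr j) => K i j

theorem inv_wMat (F : Type*) [Field F] (k : ℕ) : (wMat F k)⁻¹ = wMat F k :=
  Matrix.inv_eq_right_inv (wMat_mul_self F k)

theorem epsTilde_mul_eps {F : Type*} [Field F] {n : ℕ} {Y : Matrix (Fin n) (Fin n) F}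
    (hY : IsUnit Y) : epsTilde F n Y * eps F n Y = 1 := by
  have hYd : IsUnit Y.det := (Matrix.isUnit_iff_isUnit_det Y).mp hY
  calc epsTilde F n Y * eps F n Y
      = wMat F n * Yᵀ * (wMat F n * wMat F n) * (Y⁻¹)ᵀ * wMat F n := by
        simp only [epsTilde, eps, inv_wMat, Matrix.mul_assoc]
    _ = wMat F n * (Y⁻¹ * Y)ᵀ * wMat F n := by
        rw [wMat_mul_self, Matrix.transpose_mul, Matrix.mul_one, Matrix.mul_assoc (wMat F n)]
    _ = 1 := by
        rw [Matrix.nonsing_inv_mul Y hYd, Matrix.transpose_one, Matrix.mul_one, wMat_mul_self]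

theorem Xpr_mul_left {F : Type*} [Field F] {n m : ℕ} (X : Matrix (Fin n) (Fin (2 * m + 1)) F)
    (Y : Matrix (Fin n) (Fin n) F) : Xpr F n m (Y⁻¹ * X) = Xpr F n m X * eps F n Y := by
  calc Xpr F n m (Y⁻¹ * X)
      = -(wMat F (2 * m + 1)) * Xᵀ * (1 : Matrix (Fin n) (Fin n) F) * (Y⁻¹)ᵀ * wMat F n := by
        simp only [Xpr, Matrix.transpose_mul, Matrix.mul_assoc, Matrix.one_mul]
    _ = Xpr F n m X * eps F n Y := by
        rw [← wMat_mul_self]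
        simp only [Xpr, eps, inv_wMat, Matrix.mul_assoc]

theorem eps_sub_add_inv {F : Type*} [Field F] {n m : ℕ} {X : Matrix (Fin n) (Fin (2 * m + 1)) F}
    {Y : Matrix (Fin n) (Fin n) F} (h : Eq11 F n m X Y) (hY : IsUnit Y) :
    eps F n Y - Y⁻¹ * (X * (Xpr F n m X * eps F n Y)) + Y⁻¹ = 0 := by
  have hYd : IsUnit Y.det := (Matrix.isUnit_iff_isUnit_det Y).mp hY
  rw [← Matrix.mul_assoc X, ← show Y + epsTilde F n Y = X * Xpr F n m X from h, Matrix.add_mul,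
    epsTilde_mul_eps hY, Matrix.mul_add, ← Matrix.mul_assoc, Matrix.nonsing_inv_mul Y hYd,
    Matrix.one_mul, Matrix.mul_one]
  abel

theorem block3_mul {F : Type*} [Field F] {p q r p' q' r' p'' q'' r'' : Type*}
    [Fintype p'] [Fintype q'] [Fintype r']
    (A : Matrix p p' F) (B : Matrix p q' F) (C : Matrix p r' F)
    (D : Matrix q p' F) (E : Matrix q q' F) (G : Matrix q r' F)
    (H : Matrix r p' F) (J : Matrix r q' F) (K : Matrix r r' F)
    (A' : Matrix p' p'' F) (B' : Matrix p' q'' F) (C' : Matrix p' r'' F)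
    (D' : Matrix q' p'' F) (E' : Matrix q' q'' F) (G' : Matrix q' r'' F)
    (H' : Matrix r' p'' F) (J' : Matrix r' q'' F) (K' : Matrix r' r'' F) :
    block3 A B C D E G H J K * block3 A' B' C' D' E' G' H' J' K' =
      block3
        (A * A' + B * D' + C * H') (A * B' + B * E' + C * J') (A * C' + B * G' + C * K')
        (D * A' + E * D' + G * H') (D * B' + E * E' + G * J') (D * C' + E * G' + G * K')
        (H * A' + J * D' + K * H') (H * B' + J * E' + K * J') (H * C' + J * G' + K * K') := by
  ext (i | i | i) (j | j | j) <;>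
    simp [block3, Matrix.mul_apply, Fintype.sum_sum_type, add_assoc]

theorem block3_one {F : Type*} [Field F] {p q r : Type*}
    [DecidableEq p] [DecidableEq q] [DecidableEq r] :
    block3 (1 : Matrix p p F) 0 0 0 (1 : Matrix q q F) 0 0 0 (1 : Matrix r r F) = 1 := by
  ext (i | i | i) (j | j | j) <;> simp [block3, Matrix.one_apply]

/-- Lemma 1.1: with `u = [[I, X, Y], [0, I, X'], [0, 0, I]]` and
`w₀ = [[0, 0, I], [0, (-1)ⁿ I, 0], [I, 0, 0]]`, if `Y ∈ GL_n(F)` then `w₀⁻¹ = w₀` and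
`w₀⁻¹ u = A·B` with `A`, `B` the displayed block matrices. -/
theorem lemma_1_1 (F : Type*) [Field F] [CharZero F] (n m : ℕ)
    (X : Matrix (Fin n) (Fin (2 * m + 1)) F) (Y : Matrix (Fin n) (Fin n) F)
    (h : Eq11 F n m X Y) (hY : IsUnit Y) :
    let u : Matrix (Fin n ⊕ (Fin (2 * m + 1) ⊕ Fin n)) (Fin n ⊕ (Fin (2 * m + 1) ⊕ Fin n)) F :=
      block3 1 X Y 0 1 (Xpr F n m X) 0 0 1
    let w0 : Matrix (Fin n ⊕ (Fin (2 * m + 1) ⊕ Fin n)) (Fin n ⊕ (Fin (2 * m + 1) ⊕ Fin n)) F :=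
      block3 0 0 1 0 (((-1 : F) ^ n) • 1) 0 1 0 0
    let A : Matrix (Fin n ⊕ (Fin (2 * m + 1) ⊕ Fin n)) (Fin n ⊕ (Fin (2 * m + 1) ⊕ Fin n)) F :=
      block3 (eps F n Y) (-(Y⁻¹ * X)) 1
        0 (((-1 : F) ^ n) • (1 - Xpr F n m X * Y⁻¹ * X)) (((-1 : F) ^ n) • Xpr F n m X)
        0 0 Y
    let B : Matrix (Fin n ⊕ (Fin (2 * m + 1) ⊕ Fin n)) (Fin n ⊕ (Fin (2 * m + 1) ⊕ Fin n)) F :=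
      block3 1 0 0 (Xpr F n m (Y⁻¹ * X)) 1 0 Y⁻¹ (Y⁻¹ * X) 1
    w0⁻¹ = w0 ∧ w0⁻¹ * u = A * B := by
  intro u w0 A B
  have hYd : IsUnit Y.det := (Matrix.isUnit_iff_isUnit_det Y).mp hY
  have hw0 : w0⁻¹ = w0 := by
    refine Matrix.inv_eq_right_inv ?_
    simp only [w0, block3_mul, ← block3_one]
    simp [smul_smul, ← mul_pow]
  refine ⟨hw0, ?_⟩
  have key := eps_sub_add_inv h hY
  have key' : Xpr F n m X * eps F n Y
      - Xpr F n m X * (Y⁻¹ * (X * (Xpr F n m X * eps F n Y))) + Xpr F n m X * Y⁻¹ = 0 := by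
    rw [← Matrix.mul_sub, ← Matrix.mul_add, key, Matrix.mul_zero]
  rw [hw0]
  simp only [w0, u, A, B, block3_mul, Xpr_mul_left]
  congr 1
  · simpa [Matrix.mul_assoc, sub_eq_add_neg] using key.symm
  · simp
  · simp
  · simp only [Matrix.zero_mul, Matrix.mul_zero, Matrix.smul_mul, Matrix.sub_mul, Matrix.one_mul,
      Matrix.mul_assoc, ← smul_add, zero_add, add_zero, smul_zero, key']
  · simp [← smul_add, Matrix.mul_assoc]
  · simp
  · simp [Matrix.mul_nonsing_inv Y hYd]
  · simp [Matrix.mul_nonsing_inv_cancel_left Y _ hYd]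
  · simp
end

section
/- (Corollary 1.2) Let (X, Y) be a solution to equation (1.1) with Y ∈ GL_n(F). Then the matrix Z = (-1)ⁿ(I_{2m+1} - X'·Y⁻¹·X) lies in SO_{2m+1}(F); that is, Z · w_{2m+1} · ᵗZ = w_{2m+1} and det Z = 1. -/
open Matrix

theorem wMat_transpose (F : Type*) [Field F] (k : ℕ) : (wMat F k)ᵀ = wMat F k := by
  ext i j
  simp [wMat, add_comm]

theorem mul_Xpr_eq (F : Type*) [Field F] (n m : ℕ)
    (X : Matrix (Fin n) (Fin (2 * m + 1)) F) (Y : Matrix (Fin n) (Fin n) F)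
    (h : Eq11 F n m X Y) :
    X * wMat F (2 * m + 1) * Xᵀ = -(Y * wMat F n + wMat F n * Yᵀ) := by
  have h' := congrArg (· * wMat F n) h
  simp only [epsTilde, Xpr, add_mul, Matrix.mul_assoc, Matrix.neg_mul, Matrix.mul_neg,
    wMat_mul_self, Matrix.mul_one] at h'
  rw [h', neg_neg, Matrix.mul_assoc]

theorem one_sub_Xpr_mul_form (F : Type*) [Field F] (n m : ℕ)
    (X : Matrix (Fin n) (Fin (2 * m + 1)) F) (Y : Matrix (Fin n) (Fin n) F)
    (hY : IsUnit Y) (h : Eq11 F n m X Y) :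
    (1 - Xpr F n m X * Y⁻¹ * X) * wMat F (2 * m + 1) * (1 - Xpr F n m X * Y⁻¹ * X)ᵀ =
      wMat F (2 * m + 1) := by
  have hd := (isUnit_iff_isUnit_det Y).1 hY
  have hX := mul_Xpr_eq F n m X Y h
  have hw := wMat_mul_self F n
  have hW := wMat_mul_self F (2 * m + 1)
  have hAY : Y⁻¹ * Y = 1 := nonsing_inv_mul Y hd
  have hYA : Yᵀ * (Y⁻¹)ᵀ = 1 := by rw [← transpose_mul, hAY, transpose_one]
  have hwt := wMat_transpose F n
  have hWt := wMat_transpose F (2 * m + 1)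
  unfold Xpr
  generalize Y⁻¹ = A at *
  generalize wMat F n = w at *
  generalize wMat F (2 * m + 1) = W at *
  have hmid : w * A * (X * W * Xᵀ) * (Aᵀ * w) = -(Aᵀ * w + w * A) := by
    calc w * A * (X * W * Xᵀ) * (Aᵀ * w)
        = -(w * (A * Y) * w * (Aᵀ * w) + w * A * w * (Yᵀ * Aᵀ) * w) := by
          rw [hX]; noncomm_ring
      _ = -((w * w) * (Aᵀ * w) + w * A * (w * w)) := by
          rw [hAY, hYA]; noncomm_ring
      _ = _ := by rw [hw]; noncomm_ring
  have hexp : (1 - -W * Xᵀ * w * A * X) * W * (1 - -W * Xᵀ * w * A * X)ᵀ =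
      W + W * Xᵀ * (w * A + Aᵀ * w + w * A * (X * W * Xᵀ) * (Aᵀ * w)) * X * W := by
    have hT : (1 - -W * Xᵀ * w * A * X)ᵀ = 1 + Xᵀ * (Aᵀ * (w * (X * W))) := by
      simp [transpose_mul, hwt, hWt, Matrix.mul_assoc]
    rw [hT]
    simp only [Matrix.mul_assoc, Matrix.neg_mul, sub_neg_eq_add, Matrix.add_mul,
      Matrix.mul_add, Matrix.one_mul, Matrix.mul_one]
    abel
  rw [hexp, hmid, show w * A + Aᵀ * w + -(Aᵀ * w + w * A) = 0 by abel]
  simp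

theorem det_one_sub_Xpr_mul (F : Type*) [Field F] (n m : ℕ)
    (X : Matrix (Fin n) (Fin (2 * m + 1)) F) (Y : Matrix (Fin n) (Fin n) F)
    (hY : IsUnit Y) (h : Eq11 F n m X Y) :
    (1 - Xpr F n m X * Y⁻¹ * X).det = (-1) ^ n := by
  have hd := (isUnit_iff_isUnit_det Y).1 hY
  have hw : (wMat F n).det * (wMat F n).det = 1 := by
    rw [← det_mul, wMat_mul_self, det_one]
  have hfac : 1 - Y⁻¹ * X * Xpr F n m X = Y⁻¹ * -epsTilde F n Y := by
    rw [Matrix.mul_assoc, ← h, Matrix.mul_add, nonsing_inv_mul Y hd, Matrix.mul_neg]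
    abel
  have hYd : (Y⁻¹).det * Y.det = 1 := by
    rw [← det_mul, nonsing_inv_mul Y hd, det_one]
  rw [Matrix.mul_assoc, det_one_sub_mul_comm, hfac, det_mul, det_neg, epsTilde, det_mul,
    det_mul, det_transpose, Fintype.card_fin]
  linear_combination (-1) ^ n * (Y⁻¹).det * Y.det * hw + (-1) ^ n * hYd

/-- Corollary 1.2: if `(X, Y)` solves (1.1) with `Y` invertible, then
`Z = (-1)ⁿ(I - X'Y⁻¹X)` lies in `SO_{2m+1}(F)`. -/
theorem corollary_1_2 (F : Type*) [Field F] [CharZero F] (n m : ℕ)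
    (X : Matrix (Fin n) (Fin (2 * m + 1)) F) (Y : Matrix (Fin n) (Fin n) F)
    (hY : IsUnit Y) (h : Eq11 F n m X Y) :
    SOw F (2 * m + 1) (((-1 : F) ^ n) • (1 - Xpr F n m X * Y⁻¹ * X)) := by
  have hs : ((-1 : F) ^ n) * (-1) ^ n = 1 := by rw [← mul_pow]; simp
  constructor
  · rw [transpose_smul, Matrix.smul_mul, Matrix.smul_mul, Matrix.mul_smul, smul_smul, hs,
      one_smul, one_sub_Xpr_mul_form F n m X Y hY h]
  · rw [det_smul, det_one_sub_Xpr_mul F n m X Y hY h, Fintype.card_fin, pow_succ, pow_mul,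
      sq, hs, one_pow, one_mul, hs]
end

section
/- (Lemma 1.5) Suppose (X, Y) satisfies equation (1.1) with Y ∈ GL_n(F). Then: (a) (I_{2m+1} - X'·Y⁻¹·X)·X' = -X'·Y⁻¹·ε(Y⁻¹); and (b) X·(I_{2m+1} - X'·Y⁻¹·X) = -ε(Y⁻¹)·Y⁻¹·X. -/
open Matrix

theorem eps_inv (F : Type*) [Field F] (n : ℕ) (Y : Matrix (Fin n) (Fin n) F) (hY : IsUnit Y) :
    eps F n Y⁻¹ = epsTilde F n Y := by
  rw [eps, epsTilde, Matrix.nonsing_inv_nonsing_inv Y ((Matrix.isUnit_iff_isUnit_det Y).mp hY),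
    Matrix.inv_eq_left_inv (wMat_mul_self F n)]

/-- Lemma 1.5: if `(X, Y)` satisfies (1.1) with `Y` invertible, then
(a) `(I - X'Y⁻¹X)·X' = -X'·Y⁻¹·ε(Y⁻¹)` and (b) `X·(I - X'Y⁻¹X) = -ε(Y⁻¹)·Y⁻¹·X`. -/
theorem lemma_1_5 (F : Type*) [Field F] [CharZero F] (n m : ℕ)
    (X : Matrix (Fin n) (Fin (2 * m + 1)) F) (Y : Matrix (Fin n) (Fin n) F)
    (hY : IsUnit Y) (h : Eq11 F n m X Y) :
    (1 - Xpr F n m X * Y⁻¹ * X) * Xpr F n m X = -(Xpr F n m X * Y⁻¹ * eps F n Y⁻¹) ∧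
    X * (1 - Xpr F n m X * Y⁻¹ * X) = -(eps F n Y⁻¹ * Y⁻¹ * X) := by
  have hdet : IsUnit Y.det := (Matrix.isUnit_iff_isUnit_det Y).mp hY
  rw [eps_inv F n Y hY]
  unfold Eq11 at h
  constructor
  · rw [Matrix.sub_mul, Matrix.one_mul, Matrix.mul_assoc _ X, ← h, Matrix.mul_add,
      Matrix.nonsing_inv_mul_cancel_right _ _ hdet, sub_add_cancel_left]
  · rw [Matrix.mul_sub, Matrix.mul_one, ← Matrix.mul_assoc, ← Matrix.mul_assoc, ← h,
      Matrix.add_mul, Matrix.mul_nonsing_inv _ hdet, Matrix.add_mul, Matrix.one_mul,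
      sub_add_cancel_left]
end

section
/- (Lemma 1.6) Let m ≥ 1, let X ∈ M_{n×(2m+1)}(F), and let U = {vX : v ∈ F^n} ⊆ F^{2m+1} be the row space of X. Define H_X = {h ∈ SO_{2m+1}(F) : Xh = g_h X for some g_h ∈ GL_n(F)}. If {0} ⊊ U ⊊ F^{2m+1}, then H_X ≠ SO_{2m+1}(F), i.e., H_X is a proper subgroup of SO_{2m+1}(F). -/
open Matrix

theorem wMat_mulVec_apply (F : Type*) [Field F] (k : ℕ) (a : Fin k → F) (i : Fin k) :
    (wMat F k *ᵥ a) i = a i.rev := by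
  rw [mulVec, dotProduct, Finset.sum_eq_single i.rev]
  · have : (i : ℕ) + (k - (i + 1)) = k - 1 := by omega
    simp [wMat, Fin.val_rev, this]
  · intro j _ hj
    have : (i : ℕ) + j ≠ k - 1 := fun h => hj (Fin.ext (by rw [Fin.val_rev]; omega))
    simp [wMat, this]
  · simp

/-- Over an infinite field, a quadratic polynomial and a non-zero polynomial of degree at most one
are simultaneously non-zero at some point. -/
theorem exists_quadratic_ne_zero_and_linear_ne_zero {F : Type*} [Field F] [Infinite F]
    {a b c d e : F} (hc : c ≠ 0) (hde : d ≠ 0 ∨ e ≠ 0) :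
    ∃ t : F, a + b * t + c * t ^ 2 ≠ 0 ∧ d + e * t ≠ 0 := by
  have hp : (.C a + .C b * .X + .C c * .X ^ 2 : Polynomial F) ≠ 0 := fun h => hc <| by
    simpa [Polynomial.coeff_X, Polynomial.coeff_C] using
      congrArg (fun p => Polynomial.coeff p 2) h
  have hr : (.C d + .C e * .X : Polynomial F) ≠ 0 := fun h => by
    rcases hde with hd | he
    · exact hd (by simpa using congrArg (fun p => Polynomial.coeff p 0) h)
    · exact he (by simpa [Polynomial.coeff_C] using congrArg (fun p => Polynomial.coeff p 1) h)
  by_contra! H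
  refine mul_ne_zero hp hr (Polynomial.funext fun t => ?_)
  by_cases ht : a + b * t + c * t ^ 2 = 0
  · simp [ht]
  · simp [H t ht]

section Bilinear

variable {F ι : Type*} [Field F] [Fintype ι] {W : Matrix ι ι F}

theorem exists_anisotropic_add_smul [Infinite F] (W : Matrix ι ι F) (u x y : ι → F)
    (hy : y ⬝ᵥ W *ᵥ y ≠ 0) (hxy : u ⬝ᵥ W *ᵥ x ≠ 0 ∨ u ⬝ᵥ W *ᵥ y ≠ 0) :
    ∃ t : F, (x + t • y) ⬝ᵥ W *ᵥ (x + t • y) ≠ 0 ∧ u ⬝ᵥ W *ᵥ (x + t • y) ≠ 0 := by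
  obtain ⟨t, h₁, h₂⟩ := exists_quadratic_ne_zero_and_linear_ne_zero
    (a := x ⬝ᵥ W *ᵥ x) (b := x ⬝ᵥ W *ᵥ y + y ⬝ᵥ W *ᵥ x) hy hxy
  refine ⟨t, ?_, ?_⟩
  · convert h₁ using 1
    simp only [mulVec_add, mulVec_smul, dotProduct_add, add_dotProduct, dotProduct_smul,
      smul_dotProduct, smul_eq_mul]
    ring
  · convert h₂ using 1
    simp only [mulVec_add, mulVec_smul, dotProduct_add, dotProduct_smul, smul_eq_mul]
    ring

variable [DecidableEq ι]

/-- The negative of the reflection in the vector `a`, for the bilinear form with matrix `W`,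
acting on row vectors from the right. -/
def negReflection (W : Matrix ι ι F) (a : ι → F) : Matrix ι ι F :=
  vecMulVec ((2 / (a ⬝ᵥ W *ᵥ a)) • W *ᵥ a) a - 1

theorem vecMul_negReflection (W : Matrix ι ι F) (a u : ι → F) :
    u ᵥ* negReflection W a = (2 / (a ⬝ᵥ W *ᵥ a) * (u ⬝ᵥ W *ᵥ a)) • a - u := by
  rw [negReflection, vecMul_sub, vecMul_one, vecMul_vecMulVec, dotProduct_smul, smul_eq_mul]

theorem negReflection_mul_mul_transpose (hW : Wᵀ = W) {a : ι → F} (ha : a ⬝ᵥ W *ᵥ a ≠ 0) :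
    negReflection W a * W * (negReflection W a)ᵀ = W := by
  have haW : a ᵥ* W = W *ᵥ a := by rw [← mulVec_transpose, hW]
  rw [negReflection, transpose_sub, transpose_one, transpose_vecMulVec, sub_mul, vecMulVec_mul,
    haW, mul_sub, sub_mul, sub_mul, vecMulVec_mul_vecMulVec, mul_vecMulVec]
  ext i j
  simp [vecMulVec_apply, dotProduct_comm (W *ᵥ a) a]
  field_simp
  ring

theorem det_negReflection (hι : Odd (Fintype.card ι)) {a : ι → F} (ha : a ⬝ᵥ W *ᵥ a ≠ 0) :
    (negReflection W a).det = 1 := by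
  rw [negReflection, ← neg_sub, det_neg, hι.neg_one_pow, sub_eq_add_neg, ← neg_vecMulVec,
    vecMulVec_eq Unit, det_one_add_replicateCol_mul_replicateRow, dotProduct_neg, dotProduct_smul,
    smul_eq_mul, div_mul_cancel₀ _ ha]
  ring

/-- A non-zero subspace stable under the negatives of all reflections is the whole space. -/
theorem eq_top_of_vecMul_negReflection_mem [CharZero F] (hW : IsUnit W)
    {a₀ : ι → F} (ha₀ : a₀ ⬝ᵥ W *ᵥ a₀ ≠ 0) {S : Submodule F (ι → F)} (hS : S ≠ ⊥)
    (hinv : ∀ a, a ⬝ᵥ W *ᵥ a ≠ 0 → ∀ u ∈ S, u ᵥ* negReflection W a ∈ S) : S = ⊤ := by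
  have : Infinite F := inferInstance
  obtain ⟨u, hu, hu0⟩ := S.exists_mem_ne_zero_of_ne_bot hS
  have hmem : ∀ a, a ⬝ᵥ W *ᵥ a ≠ 0 → u ⬝ᵥ W *ᵥ a ≠ 0 → a ∈ S := fun a ha hua => by
    have h := S.add_mem (hinv a ha u hu) hu
    rw [vecMul_negReflection, sub_add_cancel] at h
    exact (S.smul_mem_iff (mul_ne_zero (div_ne_zero two_ne_zero ha) hua)).1 h
  obtain ⟨z, hz⟩ : ∃ z, u ⬝ᵥ W *ᵥ z ≠ 0 := by
    by_contra! H
    refine hu0 (dotProduct_eq_zero u fun v => ?_)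
    obtain ⟨z, rfl⟩ := mulVec_surjective_iff_isUnit.2 hW v
    exact H z
  obtain ⟨s, hs₁, hs₂⟩ := exists_anisotropic_add_smul W u z a₀ ha₀ (.inl hz)
  refine S.eq_top_iff'.2 fun x => ?_
  obtain ⟨t, ht₁, ht₂⟩ := exists_anisotropic_add_smul W u x _ hs₁ (.inr hs₂)
  exact (S.add_mem_iff_left (S.smul_mem t (hmem _ hs₁ hs₂))).1 (hmem _ ht₁ ht₂)

end Bilinear

/-- Lemma 1.6: if the row space `U` of `X` satisfies `{0} ⊊ U ⊊ F^{2m+1}`,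
then `H_X = {h ∈ SO_{2m+1}(F) : Xh = g_h X for some g_h ∈ GL_n(F)}` is a proper subset of
`SO_{2m+1}(F)`. -/
theorem lemma_1_6 (F : Type*) [Field F] [CharZero F] (n m : ℕ) (hm : 1 ≤ m)
    (X : Matrix (Fin n) (Fin (2 * m + 1)) F)
    (U : Set (Fin (2 * m + 1) → F)) (hU : U = {u | ∃ v : Fin n → F, u = v ᵥ* X})
    (hU0 : U ≠ {0}) (hUtop : U ≠ Set.univ) :
    ∃ h : Matrix (Fin (2 * m + 1)) (Fin (2 * m + 1)) F,
      SOw F (2 * m + 1) h ∧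
      ¬ (∃ g : Matrix (Fin n) (Fin n) F, IsUnit g ∧ X * h = g * X) := by
  by_contra! H
  have hSU : ((LinearMap.range X.vecMulLinear : Submodule F _) : Set _) = U := by
    ext u
    simp [hU, eq_comm]
  have hW : IsUnit (wMat F (2 * m + 1)) := by
    refine mulVec_surjective_iff_isUnit.1 fun v => ⟨wMat F _ *ᵥ v, ?_⟩
    ext i
    simp [wMat_mulVec_apply]
  refine hUtop ?_
  rw [← hSU, eq_top_of_vecMul_negReflection_mem hW (S := LinearMap.range X.vecMulLinear)
    (a₀ := Pi.single ⟨m, by omega⟩ 1), Submodule.top_coe]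
  · simp [wMat, two_mul]
  · intro hbot
    rw [hbot] at hSU
    exact hU0 (by rw [← hSU, Submodule.bot_coe])
  · rintro a ha _ ⟨v, rfl⟩
    obtain ⟨g, -, hg⟩ := H (negReflection (wMat F (2 * m + 1)) a)
      ⟨negReflection_mul_mul_transpose (wMat_transpose F _) ha,
        det_negReflection (by simp) ha⟩
    refine ⟨v ᵥ* g, ?_⟩
    simp only [vecMulLinear_apply, vecMul_vecMul, hg]
end

section
/- (Proposition 2.2, eigenvalue-multiplicity form) Suppose n < 2m, X ∈ M_{n×(2m+1)}(F), and Y ∈ GL_n(F) are such that (X, Y) satisfies equation (1.1). Let Z = (-1)ⁿ(I_{2m+1} - X'·Y⁻¹·X). Then the kernel of Z - (-1)ⁿ·I_{2m+1} (as a linear endomorphism of F^{2m+1}) has dimension at least 2m+1-n; in particular this dimension is at least 2, so Z has an eigenvalue of multiplicity at least 2 and is not a regular element. -/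
open Matrix

/-- If `A * B` factors through `F^n`, then `c • (1 - A * B) - c • 1` has a kernel of dimension
at least `k - n`. -/
theorem finrank_ker_sub_smul_one_ge {F : Type*} [Field F] {k n : ℕ} (c : F)
    (A : Matrix (Fin k) (Fin n) F) (B : Matrix (Fin n) (Fin k) F) :
    k - n ≤ Module.finrank F
      (LinearMap.ker (Matrix.toLin' (c • (1 - A * B) - c • 1))) := by
  have hle : LinearMap.ker (Matrix.toLin' B) ≤
      LinearMap.ker (Matrix.toLin' (c • (1 - A * B) - c • 1)) := by
    intro v hv
    rw [LinearMap.mem_ker, Matrix.toLin'_apply] at hv ⊢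
    have hmat : c • (1 - A * B) - c • 1 = (-c) • (A * B) := by
      rw [smul_sub, neg_smul]; abel
    rw [hmat, Matrix.smul_mulVec, ← Matrix.mulVec_mulVec, hv, Matrix.mulVec_zero, smul_zero]
  have hmono := Submodule.finrank_mono hle
  have hrank := (Matrix.toLin' B).finrank_range_add_finrank_ker
  have hrange := Submodule.finrank_le (LinearMap.range (Matrix.toLin' B))
  rw [Module.finrank_fin_fun] at hrank hrange
  omega

/-- Proposition 2.2, eigenvalue-multiplicity form: if `n < 2m` and `(X, Y)`
satisfies (1.1) with `Y` invertible, then for `Z = (-1)ⁿ(I - X'Y⁻¹X)` the kernel of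
`Z - (-1)ⁿ I` has dimension at least `2m+1-n`, and in particular at least `2`. -/
theorem prop_2_2 (F : Type*) [Field F] [CharZero F] (n m : ℕ) (hnm : n < 2 * m)
    (X : Matrix (Fin n) (Fin (2 * m + 1)) F) (Y : Matrix (Fin n) (Fin n) F)
    (hY : IsUnit Y) (h : Eq11 F n m X Y) :
    2 * m + 1 - n ≤
      Module.finrank F
        (LinearMap.ker (Matrix.toLin'
          (((-1 : F) ^ n) • (1 - Xpr F n m X * Y⁻¹ * X) - ((-1 : F) ^ n) • 1))) ∧
    2 ≤
      Module.finrank F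
        (LinearMap.ker (Matrix.toLin'
          (((-1 : F) ^ n) • (1 - Xpr F n m X * Y⁻¹ * X) - ((-1 : F) ^ n) • 1))) := by
  have key := finrank_ker_sub_smul_one_ge ((-1 : F) ^ n) (Xpr F n m X * Y⁻¹) X
  exact ⟨key, by omega⟩
end

section
/- (Lemma 2.3) Let n = 2m+1 and let S ∈ M_n(F) be such that -(I_n + S) ∈ SO_{2m+1}(F). Then there exist Y ∈ GL_n(F) and an idempotent X ∈ M_n(F) (X² = X) such that (X, Y) satisfies equation (1.1) and S = -X'·Y⁻¹·X = Y⁻¹·X = -X'·Y⁻¹. -/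
open Matrix

/-- A matrix whose kernel is contained in the kernel of its transpose is congruent to an invertible
matrix padded by zeros. -/
theorem exists_congr_fromBlocks {F ι : Type*} [Field F] [Fintype ι] [DecidableEq ι]
    (T : Matrix ι ι F) (hT : ∀ v, T *ᵥ v = 0 → Tᵀ *ᵥ v = 0) :
    ∃ (r k : ℕ) (C : Matrix ι (Fin r ⊕ Fin k) F) (D : Matrix (Fin r ⊕ Fin k) ι F)
      (M : Matrix (Fin r) (Fin r) F), C * D = 1 ∧ D * C = 1 ∧ IsUnit M ∧
        T =
          C * (fromBlocks M 0 0 0 : Matrix (Fin r ⊕ Fin k) (Fin r ⊕ Fin k) F) * Cᵀ := by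
  obtain ⟨U, hU⟩ := Submodule.exists_isCompl (LinearMap.ker T.mulVecLin)
  let bU := Module.finBasis F U
  let bK := Module.finBasis F (LinearMap.ker T.mulVecLin)
  let b := (bU.prod bK).map (Submodule.prodEquivOfIsCompl U _ hU.symm)
  have hbK (j) : T *ᵥ b (Sum.inr j) = 0 := by
    have h := (bK j).2
    rw [LinearMap.mem_ker, mulVecLin_apply] at h
    simpa [b] using h
  have hbU (j) : b (Sum.inl j) = bU j := by simp [b]
  let E := (Pi.basisFun F ι).toMatrix b
  let E' := b.toMatrix (Pi.basisFun F ι)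
  have hEE' : E * E' = 1 := Module.Basis.toMatrix_mul_toMatrix_flip _ _
  have hE'E : E' * E = 1 := Module.Basis.toMatrix_mul_toMatrix_flip _ _
  have hEcol (j) : E.col j = b j := by
    ext i; simp [E, Module.Basis.toMatrix_apply]
  let N := Eᵀ * T * E
  have hcol (i) (j) : N i (Sum.inr j) = 0 := by
    have : (T * E).col (Sum.inr j) = 0 := by
      rw [← hbK j, ← hEcol]; rfl
    simp only [N, Matrix.mul_assoc, Matrix.mul_apply (M := Eᵀ)]
    exact Finset.sum_eq_zero fun x _ => by
      rw [show (T * E) x (Sum.inr j) = 0 from congrFun this x, mul_zero]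
  have hrow (i) (j) : N (Sum.inr j) i = 0 := by
    have : (Tᵀ * E).col (Sum.inr j) = 0 := by
      rw [← hT _ (hbK j), ← hEcol]; rfl
    have h2 : N = (Tᵀ * E)ᵀ * E := by simp [N]
    rw [h2, Matrix.mul_apply]
    exact Finset.sum_eq_zero fun x _ => by
      rw [transpose_apply, show (Tᵀ * E) x (Sum.inr j) = 0 from congrFun this x, zero_mul]
  have hN : N = fromBlocks N.toBlocks₁₁ 0 0 0 := by
    ext (i | i) (j | j) <;> simp [hcol, hrow, toBlocks₁₁]
  have hTN : T * E = E'ᵀ * N := by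
    simp only [N, ← Matrix.mul_assoc, ← transpose_mul, hEE', transpose_one, Matrix.one_mul]
  refine ⟨_, _, E'ᵀ, Eᵀ, N.toBlocks₁₁, ?_, ?_, ?_, ?_⟩
  · rw [← transpose_mul, hEE', transpose_one]
  · rw [← transpose_mul, hE'E, transpose_one]
  · rw [← mulVec_injective_iff_isUnit, ← coe_mulVecLin, injective_iff_map_eq_zero]
    intro v hv
    rw [mulVecLin_apply] at hv
    have hu : E *ᵥ Sum.elim v 0 = ((∑ i, v i • bU i : U) : ι → F) := by
      rw [mulVec_eq_sum]
      simp only [Fintype.sum_sum_type, Sum.elim_inl, Sum.elim_inr, Pi.zero_apply, op_smul_eq_smul,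
        zero_smul, Finset.sum_const_zero, add_zero, Submodule.coe_sum, Submodule.coe_smul, ← hbU,
        ← hEcol]
      rfl
    have hK : T *ᵥ (E *ᵥ Sum.elim v 0) = 0 := by
      rw [mulVec_mulVec, hTN, ← mulVec_mulVec, hN, fromBlocks_mulVec]
      simp [hv]
    have h0 : (∑ i, v i • bU i) = 0 := by
      rw [← Submodule.coe_eq_zero, ← hu]
      exact Submodule.disjoint_def.1 hU.disjoint _ (by simpa using hK) (hu ▸ Subtype.prop _)
    exact funext (Fintype.linearIndependent_iff.1 bU.linearIndependent v h0)
  · rw [← hN, ← hTN, transpose_transpose, Matrix.mul_assoc, hEE', Matrix.mul_one]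

/-- If `M` is invertible and `M + Mᵀ + M G Mᵀ = 0`, then `det (1 + M G) = (-1) ^ r`. -/
theorem det_one_add_mul_of_add_transpose_eq_zero {F : Type*} [Field F] {r : ℕ}
    {M G : Matrix (Fin r) (Fin r) F} (hM : IsUnit M) (h : M + Mᵀ + M * G * Mᵀ = 0) :
    (1 + M * G).det = (-1) ^ r := by
  have h1 : (1 + M * G) * Mᵀ = -M := by
    rw [add_mul, Matrix.one_mul, eq_neg_iff_add_eq_zero, ← h]; abel
  have h2 := congrArg det h1
  rw [det_mul, det_transpose, det_neg, Fintype.card_fin] at h2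
  exact mul_right_cancel₀ ((isUnit_iff_isUnit_det M).1 hM).ne_zero h2

theorem exists_isUnit_transpose_eq_neg (F : Type*) [Field F] {k : ℕ} (hk : Even k) :
    ∃ J : Matrix (Fin k) (Fin k) F, IsUnit J ∧ Jᵀ = -J := by
  obtain ⟨l, rfl⟩ := hk
  refine ⟨reindex finSumFinEquiv finSumFinEquiv (J (Fin l) F), ?_, ?_⟩
  · rw [isUnit_iff_isUnit_det, det_reindex_self]
    exact isUnit_det_J _ _
  · rw [transpose_reindex, J_transpose]; rfl

/-- Lemma 2.3: let `n = 2m+1` and `S ∈ M_n(F)` with `-(I + S) ∈ SO_{2m+1}(F)`.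
Then there exist `Y ∈ GL_n(F)` and an idempotent `X ∈ M_n(F)` with `(X, Y)` satisfying (1.1)
and `S = -X'Y⁻¹X = Y⁻¹X = -X'Y⁻¹`. -/
theorem lemma_2_3 (F : Type*) [Field F] [CharZero F] (m : ℕ)
    (S : Matrix (Fin (2 * m + 1)) (Fin (2 * m + 1)) F)
    (hS : SOw F (2 * m + 1) (-(1 + S))) :
    ∃ (Y X : Matrix (Fin (2 * m + 1)) (Fin (2 * m + 1)) F),
      IsUnit Y ∧ X * X = X ∧ Eq11 F (2 * m + 1) m X Y ∧
      S = -(Xpr F (2 * m + 1) m X * Y⁻¹ * X) ∧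
      S = Y⁻¹ * X ∧
      S = -(Xpr F (2 * m + 1) m X * Y⁻¹) := by
  set w := wMat F (2 * m + 1) with hw
  have hww : w * w = 1 := wMat_mul_self F _
  have hwt : wᵀ = w := wMat_transpose F _
  have hwl {κ : Type} (A : Matrix (Fin (2 * m + 1)) κ F) : w * (w * A) = A := by
    rw [← Matrix.mul_assoc, hww, Matrix.one_mul]
  obtain ⟨hS1, hSdet⟩ := hS
  obtain ⟨T, rfl⟩ : ∃ T, S = T * w := ⟨S * w, by rw [Matrix.mul_assoc, hww, Matrix.mul_one]⟩
  have hT : T + Tᵀ + T * w * Tᵀ = 0 := by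
    rw [← hw] at hS1
    simp only [transpose_neg, transpose_add, transpose_one, transpose_mul, hwt, neg_mul, mul_neg,
      add_mul, mul_add, Matrix.one_mul, Matrix.mul_one, Matrix.mul_assoc, hww, hwl] at hS1
    rw [Matrix.mul_assoc, ← sub_eq_zero.2 hS1]
    abel
  have hker (v) (hv : T *ᵥ v = 0) : Tᵀ *ᵥ v = 0 := by
    have h : (1 + T * w) * Tᵀ = -T := by
      rw [add_mul, Matrix.one_mul, eq_neg_iff_add_eq_zero, ← hT]; abel
    have hu : IsUnit (1 + T * w) := by
      rw [← IsUnit.neg_iff, isUnit_iff_isUnit_det, hSdet]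
      exact isUnit_one
    refine mulVec_injective_of_isUnit hu ?_
    rw [mulVec_mulVec, h, neg_mulVec, hv, mulVec_zero, neg_zero]
  obtain ⟨r, k, C, D, M, hCD, hDC, hM, rfl⟩ := exists_congr_fromBlocks T hker
  have hrk : r + k = 2 * m + 1 := by
    simpa using (toLin'OfInv hCD hDC).finrank_eq.symm
  have hDCl {κ : Type} (A : Matrix (Fin r ⊕ Fin k) κ F) : D * (C * A) = A := by
    rw [← Matrix.mul_assoc, hDC, Matrix.one_mul]
  have hCDt : Cᵀ * Dᵀ = 1 := by rw [← transpose_mul, hDC, transpose_one]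
  have hCDtl {κ : Type} (A : Matrix (Fin r ⊕ Fin k) κ F) : Cᵀ * (Dᵀ * A) = A := by
    rw [← Matrix.mul_assoc, hCDt, Matrix.one_mul]
  have hDCt : Dᵀ * Cᵀ = 1 := by rw [← transpose_mul, hCD, transpose_one]
  have hDCtl {κ : Type} (A : Matrix (Fin (2 * m + 1)) κ F) : Dᵀ * (Cᵀ * A) = A := by
    rw [← Matrix.mul_assoc, hDCt, Matrix.one_mul]
  obtain ⟨N, hN⟩ : ∃ N : Matrix (Fin r ⊕ Fin k) (Fin r ⊕ Fin k) F, N = fromBlocks M 0 0 0 :=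
    ⟨_, rfl⟩
  obtain ⟨G, hG⟩ : ∃ G, G = Cᵀ * w * C := ⟨_, rfl⟩
  rw [← hN] at hT hSdet ⊢
  have hNG : N + Nᵀ + N * G * Nᵀ = 0 := by
    have h := congrArg (fun A => D * A * Dᵀ) hT
    simpa only [transpose_mul, transpose_transpose, Matrix.mul_add, Matrix.add_mul,
      Matrix.mul_assoc, hDCl, hCDt, Matrix.mul_one, Matrix.mul_zero, Matrix.zero_mul, hG] using h
  have hMG : M + Mᵀ + M * G.toBlocks₁₁ * Mᵀ = 0 := by
    rw [hN, ← fromBlocks_toBlocks G] at hNG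
    simp only [fromBlocks_transpose, fromBlocks_multiply, fromBlocks_add] at hNG
    have h := congrArg toBlocks₁₁ hNG
    simp only [toBlocks_fromBlocks₁₁, Matrix.mul_zero, Matrix.zero_mul, transpose_zero, add_zero] at h
    exact h
  have hdet : (1 + M * G.toBlocks₁₁).det = -1 := by
    have h : (1 + C * N * Cᵀ * w).det = (1 + M * G.toBlocks₁₁).det := by
      rw [Matrix.mul_assoc, Matrix.mul_assoc, det_one_add_mul_comm, Matrix.mul_assoc, ← hG, hN,
        ← fromBlocks_toBlocks G, fromBlocks_multiply, ← fromBlocks_one, fromBlocks_add]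
      simp
    rw [det_neg, Fintype.card_fin, h, Odd.neg_one_pow ⟨m, rfl⟩] at hSdet
    linear_combination -hSdet
  rw [det_one_add_mul_of_add_transpose_eq_zero hM hMG] at hdet
  have hk : Even k := by
    rcases Nat.even_or_odd r with hr | hr
    · rw [hr.neg_one_pow] at hdet
      norm_num [eq_neg_iff_add_eq_zero] at hdet
    · grind
  obtain ⟨J, hJ, hJt⟩ := exists_isUnit_transpose_eq_neg F hk
  obtain ⟨K, hK⟩ : ∃ K, K = fromBlocks M 0 0 J := ⟨_, rfl⟩
  obtain ⟨P, hP⟩ : ∃ P : Matrix (Fin r ⊕ Fin k) (Fin r ⊕ Fin k) F, P = fromBlocks 1 0 0 0 :=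
    ⟨_, rfl⟩
  have hKdet : IsUnit K.det := by
    rw [hK, det_fromBlocks_zero₂₁]
    exact ((isUnit_iff_isUnit_det M).1 hM).mul ((isUnit_iff_isUnit_det J).1 hJ)
  have hPP : P * P = P := by simp [hP, fromBlocks_multiply]
  have hPt : Pᵀ = P := by simp [hP, fromBlocks_transpose]
  have hKP : K * P = N := by simp [hP, hK, hN, fromBlocks_multiply]
  have hPK : P * K = N := by simp [hP, hK, hN, fromBlocks_multiply]
  have hPN : P * N = N := by simp [hP, hN, fromBlocks_multiply]
  have hKN : K + Kᵀ = N + Nᵀ := by simp [hK, hN, fromBlocks_transpose, fromBlocks_add, hJt]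
  have hinv : K⁻¹ + (K⁻¹)ᵀ = -(P * G * P) := by
    have hKtdet : IsUnit Kᵀ.det := by rwa [det_transpose]
    have h : K * (P * G * P) * Kᵀ = -(K + Kᵀ) := by
      rw [hKN, eq_neg_iff_add_eq_zero, ← hNG, ← hKP, transpose_mul, hPt]
      simp only [Matrix.mul_assoc]
      abel
    have h2 : P * G * P = K⁻¹ * (K * (P * G * P) * Kᵀ) * Kᵀ⁻¹ := by
      simp only [Matrix.mul_assoc, nonsing_inv_mul_cancel_left _ _ hKdet, mul_nonsing_inv _ hKtdet,
        Matrix.mul_one]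
    rw [h2, h, mul_neg, neg_mul, neg_neg, mul_add, add_mul, nonsing_inv_mul _ hKdet,
      Matrix.mul_assoc, mul_nonsing_inv _ hKtdet, Matrix.mul_one, Matrix.one_mul,
      transpose_nonsing_inv, add_comm]
  have hYZ : w * Dᵀ * K⁻¹ * D * (C * K * Cᵀ * w) = 1 := by
    simp only [Matrix.mul_assoc, hDCl, nonsing_inv_mul_cancel_left _ _ hKdet, hDCtl, hww]
  have hX : Xpr F (2 * m + 1) m (w * Dᵀ * P * Cᵀ * w) = -(C * P * D) := by
    simp only [Xpr, ← hw, transpose_mul, transpose_transpose, hwt, hPt, Matrix.mul_assoc, neg_mul,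
      hwl, hww, Matrix.mul_one]
  refine ⟨w * Dᵀ * K⁻¹ * D, w * Dᵀ * P * Cᵀ * w, IsUnit.of_mul_eq_one _ hYZ, ?_, ?_, ?_⟩
  · simp only [Matrix.mul_assoc, hwl, hCDtl]
    rw [← Matrix.mul_assoc P P, hPP]
  · have h : w * (w * Dᵀ * K⁻¹ * D)ᵀ * w = w * Dᵀ * (K⁻¹)ᵀ * D := by
      simp only [transpose_mul, transpose_transpose, hwt, Matrix.mul_assoc, hww, Matrix.mul_one]
    rw [Eq11, hX, epsTilde, ← hw, h, ← Matrix.add_mul, ← Matrix.mul_add, hinv, hG]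
    simp only [Matrix.mul_assoc, Matrix.neg_mul, Matrix.mul_neg]
  · rw [hX, inv_eq_right_inv hYZ]
    refine ⟨?_, ?_, ?_⟩
    · simp only [neg_mul, neg_neg, Matrix.mul_assoc, hDCl, hwl, hCDtl]
      rw [← Matrix.mul_assoc K P, hKP, ← Matrix.mul_assoc P N, hPN]
    · simp only [Matrix.mul_assoc, hwl, hCDtl]
      rw [← Matrix.mul_assoc K P, hKP]
    · simp only [neg_mul, neg_neg, Matrix.mul_assoc, hDCl]
      rw [← Matrix.mul_assoc P K, hPK]
end

section
/- (Proposition 2.7) Let n = 2m+1 and let h ∈ SO_{2m+1}(F) be semisimple. Then there exist Y ∈ GL_n(F) and X ∈ M_n(F) such that (X, Y) satisfies equation (1.1) and h = -(I_n - X'·Y⁻¹·X). -/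
open Matrix

/-- Every matrix over a field factors through its rank, as a matrix with a left inverse times a
matrix with a right inverse. -/
theorem exists_rank_factorization {F n : Type*} [Field F] [Fintype n] [DecidableEq n]
    (A : Matrix n n F) :
    ∃ (r : ℕ) (L : Matrix n (Fin r) F) (R : Matrix (Fin r) n F)
      (L' : Matrix (Fin r) n F) (R' : Matrix n (Fin r) F),
      r ≤ Fintype.card n ∧ A = L * R ∧ L' * L = 1 ∧ R * R' = 1 := by
  let f := Matrix.toLin' A
  let b := Module.finBasis F (LinearMap.range f)
  let c := Pi.basisFun F n
  obtain ⟨g, hg⟩ := (LinearMap.range f).subtype.exists_leftInverse_of_injective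
    (Submodule.ker_subtype _)
  obtain ⟨k, hk⟩ := f.rangeRestrict.exists_rightInverse_of_surjective
    (LinearMap.range_rangeRestrict f)
  refine ⟨_, LinearMap.toMatrix b c (LinearMap.range f).subtype,
    LinearMap.toMatrix c b f.rangeRestrict, LinearMap.toMatrix c b g,
    LinearMap.toMatrix b c k, ?_, ?_, ?_, ?_⟩
  · exact (Submodule.finrank_le _).trans_eq (Module.finrank_fintype_fun_eq_card F)
  · rw [← LinearMap.toMatrix_comp, LinearMap.subtype_comp_codRestrict]
    exact (LinearMap.toMatrix'_toLin' A).symm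
  · rw [← LinearMap.toMatrix_comp, hg, LinearMap.toMatrix_id]
  · rw [← LinearMap.toMatrix_comp, hk, LinearMap.toMatrix_id]

/-- The Wall form: an isometry `g` of the symmetric form `w` is
`1 + w * Rᵀ * M⁻¹ * R` with `M` invertible and `M + Mᵀ = -(R * w * Rᵀ)`. -/
theorem exists_wall_form {F n : Type*} [Field F] [Fintype n] [DecidableEq n]
    {w g : Matrix n n F} (hw : wᵀ = w) (hww : w * w = 1) (hg : g * w * gᵀ = w) :
    ∃ (r : ℕ) (R : Matrix (Fin r) n F) (M : Matrix (Fin r) (Fin r) F),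
      r ≤ Fintype.card n ∧ IsUnit M.det ∧ M + Mᵀ = -(R * w * Rᵀ) ∧ g = 1 + w * Rᵀ * M⁻¹ * R := by
  obtain ⟨r, L, R, L', R', hr, hLR, hL, hR⟩ := exists_rank_factorization (g - 1)
  have hg' : g = 1 + L * R := by rw [← hLR]; abel
  have hLt : Lᵀ * L'ᵀ = 1 := by rw [← transpose_mul, hL, transpose_one]
  have hRt : R'ᵀ * Rᵀ = 1 := by rw [← transpose_mul, hR, transpose_one]
  have key : L * R * w + w * Rᵀ * Lᵀ + L * (R * w * Rᵀ) * Lᵀ = 0 := by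
    have h1 : (1 + L * R) * w * (1 + L * R)ᵀ - w = 0 := by rw [← hg', hg, sub_self]
    rw [← h1, transpose_add, transpose_mul, transpose_one]
    simp only [Matrix.mul_add, Matrix.add_mul, Matrix.mul_assoc, Matrix.mul_one, Matrix.one_mul]
    abel
  let M := -(R * w * L'ᵀ + R * w * Rᵀ)
  have hM : L * M = w * Rᵀ := by
    have h2 : (L * R * w + w * Rᵀ * Lᵀ + L * (R * w * Rᵀ) * Lᵀ) * L'ᵀ = 0 := by
      rw [key, Matrix.zero_mul]
    simp only [Matrix.add_mul, Matrix.mul_assoc, hLt, Matrix.mul_one] at h2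
    simp only [M, Matrix.mul_neg, Matrix.mul_add, Matrix.mul_assoc]
    rw [neg_eq_iff_add_eq_zero, ← h2]
    abel
  have hMu : IsUnit M.det := by
    have h3 : (R'ᵀ * w * L) * M = 1 := by
      rw [Matrix.mul_assoc, hM, Matrix.mul_assoc, ← Matrix.mul_assoc w, hww, Matrix.one_mul, hRt]
    exact isUnit_det_of_left_inverse h3
  have hMt : Mᵀ * Lᵀ = R * w := by
    rw [← transpose_mul, hM, transpose_mul, transpose_transpose, hw]
  refine ⟨r, R, M, hr, hMu, ?_, ?_⟩
  · have h4 : L * (M + Mᵀ + R * w * Rᵀ) * Lᵀ = 0 := by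
      rw [← key, ← hM, Matrix.mul_assoc L R w, ← hMt]
      simp only [Matrix.mul_add, Matrix.add_mul, Matrix.mul_assoc]
      abel
    have h5 : L' * (L * (M + Mᵀ + R * w * Rᵀ) * Lᵀ) * L'ᵀ = 0 := by
      rw [h4, Matrix.mul_zero, Matrix.zero_mul]
    rw [Matrix.mul_assoc, Matrix.mul_assoc _ Lᵀ, hLt, Matrix.mul_one, ← Matrix.mul_assoc, hL,
      Matrix.one_mul] at h5
    exact eq_neg_of_add_eq_zero_left h5
  · rw [← hM, Matrix.mul_assoc L M, mul_nonsing_inv _ hMu, Matrix.mul_one, hg']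

/-- The determinant of an isometry in terms of the size of its Wall form. -/
theorem det_wall_form {F n : Type*} [Field F] [Fintype n] [DecidableEq n] {r : ℕ}
    {w : Matrix n n F} {R : Matrix (Fin r) n F} {M : Matrix (Fin r) (Fin r) F}
    (hM : IsUnit M.det) (hMR : M + Mᵀ = -(R * w * Rᵀ)) :
    (1 + w * Rᵀ * M⁻¹ * R).det = (-1) ^ r := by
  have h1 : 1 + R * (w * Rᵀ * M⁻¹) = -(Mᵀ * M⁻¹) := by
    have h2 : R * w * Rᵀ = -(M + Mᵀ) := by rw [hMR, neg_neg]
    rw [← Matrix.mul_assoc, ← Matrix.mul_assoc, h2, Matrix.neg_mul, Matrix.add_mul,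
      mul_nonsing_inv _ hM]
    abel
  rw [det_one_add_mul_comm, h1, det_neg, det_mul, det_transpose, det_nonsing_inv,
    Ring.mul_inverse_cancel _ hM, Fintype.card_fin, mul_one]

/-- A Wall form can be padded by a symplectic block to a square one of full size. -/
theorem exists_padded_wall_form {F : Type*} [Field F] {n r t : ℕ}
    {w : Matrix (Fin n) (Fin n) F} {R : Matrix (Fin r) (Fin n) F} {M : Matrix (Fin r) (Fin r) F}
    (hM : IsUnit M.det) (hMR : M + Mᵀ = -(R * w * Rᵀ)) (hn : n = r + (t + t)) :
    ∃ X B : Matrix (Fin n) (Fin n) F, IsUnit B ∧ B + Bᵀ = -(X * w * Xᵀ) ∧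
      w * Xᵀ * B⁻¹ * X = w * Rᵀ * M⁻¹ * R := by
  let e : Fin n ≃ Fin r ⊕ (Fin t ⊕ Fin t) :=
    (finCongr hn).trans (finSumFinEquiv.symm.trans (Equiv.sumCongr (Equiv.refl _)
      finSumFinEquiv.symm))
  let X₀ : Matrix (Fin r ⊕ (Fin t ⊕ Fin t)) (Fin n) F := fromRows R 0
  let B₀ := fromBlocks M 0 0 (Matrix.J (Fin t) F)
  have hJ : IsUnit (Matrix.J (Fin t) F).det := isUnit_det_J _ _
  have hB₀ : IsUnit B₀ := by
    rw [isUnit_iff_isUnit_det, det_fromBlocks_zero₂₁]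
    exact hM.mul hJ
  have hinv : B₀⁻¹ = fromBlocks M⁻¹ 0 0 (Matrix.J (Fin t) F)⁻¹ := by
    refine inv_eq_right_inv ?_
    simp [B₀, fromBlocks_multiply, mul_nonsing_inv _ hM, mul_nonsing_inv _ hJ]
  refine ⟨X₀.submatrix e id, B₀.submatrix e e, ?_, ?_, ?_⟩
  · rw [isUnit_submatrix_equiv]
    exact hB₀
  · have h1 : B₀ + B₀ᵀ = -(X₀ * w * X₀ᵀ) := by
      rw [transpose_fromRows, fromRows_mul, fromRows_mul_fromCols, fromBlocks_transpose,
        fromBlocks_add, hMR, J_transpose]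
      simp [fromBlocks_neg]
    exact congrArg (fun Z => Z.submatrix e e) h1
  · rw [inv_submatrix_equiv, transpose_submatrix, Matrix.mul_assoc, submatrix_mul_equiv, hinv,
      Matrix.mul_assoc]
    simp [X₀, transpose_fromRows, fromBlocks_mul_fromRows, fromCols_mul_fromRows, Matrix.mul_assoc]

/-- Proposition 2.7: for `n = 2m+1` and `h ∈ SO_{2m+1}(F)` semisimple, there
exist `Y ∈ GL_n(F)` and `X ∈ M_n(F)` with `(X, Y)` satisfying (1.1) and
`h = -(I - X'Y⁻¹X)`. -/
theorem prop_2_7 (F : Type*) [Field F] [CharZero F] (m : ℕ)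
    (h : Matrix (Fin (2 * m + 1)) (Fin (2 * m + 1)) F) (hSO : SOw F (2 * m + 1) h)
    (hss : Squarefree (minpoly F h)) :
    ∃ (Y X : Matrix (Fin (2 * m + 1)) (Fin (2 * m + 1)) F),
      IsUnit Y ∧ Eq11 F (2 * m + 1) m X Y ∧
      h = -(1 - Xpr F (2 * m + 1) m X * Y⁻¹ * X) := by
  set w := wMat F (2 * m + 1) with hw
  have hwt : wᵀ = w := wMat_transpose F _
  have hww : w * w = 1 := wMat_mul_self F _
  have hg : -h * w * (-h)ᵀ = w := by
    simpa using hSO.1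
  obtain ⟨r, R, M, hrn, hM, hMR, hgR⟩ := exists_wall_form hwt hww hg
  have hdet : (-1 : F) ^ r = -1 := by
    rw [← det_wall_form hM hMR, ← hgR, det_neg, hSO.2, Fintype.card_fin, mul_one,
      Odd.neg_one_pow ⟨m, rfl⟩]
  have hr : Odd r := by
    rcases Nat.even_or_odd r with hr | hr
    · rw [hr.neg_one_pow] at hdet
      norm_num [eq_neg_iff_add_eq_zero] at hdet
    · exact hr
  rw [Fintype.card_fin] at hrn
  obtain ⟨s, rfl⟩ := hr
  obtain ⟨X, B, hB, hBX, hX⟩ := exists_padded_wall_form (t := m - s) hM hMR (by omega)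
  have hwinv : w⁻¹ = w := inv_eq_right_inv hww
  have hwu : IsUnit w := IsUnit.of_mul_eq_one w hww
  refine ⟨B * w, X, hB.mul hwu, ?_, ?_⟩
  · rw [Eq11, epsTilde, Xpr, ← hw, transpose_mul, hwt, ← Matrix.mul_assoc w w, hww, Matrix.one_mul,
      ← Matrix.add_mul, hBX]
    simp only [Matrix.neg_mul, Matrix.mul_neg, Matrix.mul_assoc]
  · have h1 : Xpr F (2 * m + 1) m X * (B * w)⁻¹ * X = -(w * Xᵀ * B⁻¹ * X) := by
      rw [Xpr, ← hw, Matrix.mul_inv_rev, hwinv, Matrix.mul_assoc _ w, ← Matrix.mul_assoc w w, hww,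
        Matrix.one_mul]
      simp only [Matrix.neg_mul]
    rw [h1, hX, sub_neg_eq_add, ← hgR, neg_neg]
end

section
/- (Key step of Lemma 2.9) Let n = 2m+1, let Y ∈ GL_n(F), and let X ∈ M_n(F) be such that (X, Y) satisfies equation (1.1). Then for every row vector v ∈ F^n with vX = 0, one has v·ε(Y⁻¹)·Y⁻¹ = -v. (Here ε(Y⁻¹) = w_n · ᵗY · w_n = ε̃(Y).) Consequently the left kernel of X is an invariant subspace on which ε(Y⁻¹)Y⁻¹ acts by -1. -/
open Matrix

/-- For invertible `Y`, `ε(Y⁻¹) = ε̃(Y)`. -/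
theorem eps_inv_eq_epsTilde (F : Type*) [Field F] (n : ℕ) {Y : Matrix (Fin n) (Fin n) F}
    (hY : IsUnit Y) : eps F n Y⁻¹ = epsTilde F n Y := by
  rw [eps, epsTilde, nonsing_inv_nonsing_inv _ ((isUnit_iff_isUnit_det _).1 hY),
    inv_eq_right_inv (wMat_mul_self F n)]

/-- key step of Lemma 2.9: for `n = 2m+1`, if `(X, Y)` satisfies (1.1) with
`Y` invertible, then every row vector `v` with `vX = 0` satisfies `v·ε(Y⁻¹)·Y⁻¹ = -v`. -/
theorem lemma_2_9_key (F : Type*) [Field F] [CharZero F] (m : ℕ)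
    (X Y : Matrix (Fin (2 * m + 1)) (Fin (2 * m + 1)) F)
    (hY : IsUnit Y) (h : Eq11 F (2 * m + 1) m X Y) :
    ∀ v : Fin (2 * m + 1) → F, v ᵥ* X = 0 →
      v ᵥ* (eps F (2 * m + 1) Y⁻¹ * Y⁻¹) = -v := by
  intro v hv
  have hsum : v ᵥ* Y + v ᵥ* epsTilde F (2 * m + 1) Y = 0 := by
    rw [← vecMul_add, show Y + epsTilde F (2 * m + 1) Y = _ from h, ← vecMul_vecMul, hv,
      zero_vecMul]
  rw [eps_inv_eq_epsTilde F _ hY, ← vecMul_vecMul, eq_neg_of_add_eq_zero_right hsum, neg_vecMul,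
    vecMul_vecMul, mul_nonsing_inv _ ((isUnit_iff_isUnit_det _).1 hY), vecMul_one]
end

section
/- (Lemma 4.3, identity form) Let λ ∈ F with λ ≠ 0, set α = λ², and let α₀ = diag(α·I_m, λ, I_m) ∈ GL_{2m+1}(F). Suppose (X, Y) satisfies equation (1.1) with Y ∈ GL_n(F). Then the pair (X·α₀, α·Y) also satisfies equation (1.1), i.e., αY + ε̃(αY) = (Xα₀)·(Xα₀)', and moreover I_{2m+1} - (Xα₀)'·(αY)⁻¹·(Xα₀) = α₀⁻¹ · (I_{2m+1} - X'·Y⁻¹·X) · α₀. -/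
open Matrix

/-- A diagonal matrix `d` with `d_i d_{k+1-i} = a` is a similitude of the form `w_k`. -/
theorem diagonal_mul_wMat_mul_diagonal (F : Type*) [Field F] (k : ℕ) (d : Fin k → F) (a : F)
    (hd : ∀ i j : Fin k, (i : ℕ) + (j : ℕ) = k - 1 → d i * d j = a) :
    diagonal d * wMat F k * diagonal d = a • wMat F k := by
  ext i j
  rw [mul_diagonal, diagonal_mul, Matrix.smul_apply, wMat, of_apply]
  split_ifs with hij
  · simpa using hd i j hij
  · simp

/-- If `D` is a symmetric invertible similitude of `w_{2m+1}` with factor `a`, then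
`Xpr (X D) = a D⁻¹ Xpr X`. -/
theorem Xpr_mul_s19 (F : Type*) [Field F] (n m : ℕ)
    (X : Matrix (Fin n) (Fin (2 * m + 1)) F) (a : F)
    (D : Matrix (Fin (2 * m + 1)) (Fin (2 * m + 1)) F) (hD : IsUnit D.det) (hsymm : Dᵀ = D)
    (hsim : D * wMat F (2 * m + 1) * D = a • wMat F (2 * m + 1)) :
    Xpr F n m (X * D) = a • (D⁻¹ * Xpr F n m X) := by
  have hw : wMat F (2 * m + 1) * D = a • (D⁻¹ * wMat F (2 * m + 1)) := by
    rw [← Matrix.mul_smul, ← hsim, Matrix.mul_assoc, nonsing_inv_mul_cancel_left _ _ hD]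
  rw [Xpr, Xpr, transpose_mul, hsymm, ← Matrix.mul_assoc, Matrix.neg_mul, hw]
  simp only [Matrix.neg_mul, Matrix.mul_neg, Matrix.smul_mul, Matrix.mul_assoc, smul_neg]

/-- Lemma 4.3, identity form: for `λ ≠ 0`, `α = λ²`,
`α₀ = diag(α I_m, λ, I_m)`, if `(X, Y)` satisfies (1.1) with `Y` invertible, then
`(Xα₀, αY)` also satisfies (1.1) and
`I - (Xα₀)'(αY)⁻¹(Xα₀) = α₀⁻¹ (I - X'Y⁻¹X) α₀`. -/
theorem lemma_4_3 (F : Type*) [Field F] [CharZero F] (n m : ℕ)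
    (lam : F) (hlam : lam ≠ 0)
    (X : Matrix (Fin n) (Fin (2 * m + 1)) F) (Y : Matrix (Fin n) (Fin n) F)
    (hY : IsUnit Y) (h : Eq11 F n m X Y) :
    let alpha : F := lam ^ 2
    let alpha0 : Matrix (Fin (2 * m + 1)) (Fin (2 * m + 1)) F :=
      Matrix.diagonal (fun j => if (j : ℕ) < m then alpha else if (j : ℕ) = m then lam else 1)
    Eq11 F n m (X * alpha0) (alpha • Y) ∧
    1 - Xpr F n m (X * alpha0) * (alpha • Y)⁻¹ * (X * alpha0) =
      alpha0⁻¹ * (1 - Xpr F n m X * Y⁻¹ * X) * alpha0 := by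
  intro alpha alpha0
  have halpha : alpha ≠ 0 := pow_ne_zero 2 hlam
  have hdet : IsUnit alpha0.det := by
    rw [det_diagonal, isUnit_iff_ne_zero, Finset.prod_ne_zero_iff]
    intro j _
    split_ifs
    exacts [halpha, hlam, one_ne_zero]
  have hsim : alpha0 * wMat F (2 * m + 1) * alpha0 = alpha • wMat F (2 * m + 1) := by
    refine diagonal_mul_wMat_mul_diagonal F _ _ _ fun i j hij => ?_
    split_ifs <;> first | omega | simp [alpha, sq]
  have hX : Xpr F n m (X * alpha0) = alpha • (alpha0⁻¹ * Xpr F n m X) :=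
    Xpr_mul_s19 F n m X alpha alpha0 hdet (diagonal_transpose _) hsim
  have hYinv : (alpha • Y)⁻¹ = alpha⁻¹ • Y⁻¹ :=
    inv_smul' Y (Units.mk0 alpha halpha) ((isUnit_iff_isUnit_det Y).1 hY)
  rw [Eq11] at h ⊢
  constructor
  · rw [hX, Matrix.mul_smul, Matrix.mul_assoc, mul_nonsing_inv_cancel_left _ _ hdet, ← h,
      smul_add, epsTilde, epsTilde, transpose_smul, Matrix.mul_smul, Matrix.smul_mul]
  · rw [hX, hYinv, Matrix.mul_sub, Matrix.sub_mul, Matrix.mul_one, nonsing_inv_mul _ hdet]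
    simp only [Matrix.smul_mul, Matrix.mul_smul, smul_smul, inv_mul_cancel₀ halpha, one_smul,
      Matrix.mul_assoc]
end
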